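/- For all integers m ≥ 1 and a, b ≥ 1, the inner product of rooted trees descends to a well-defined ℤ-bilinear pairing ⟨·,·⟩ : L'_a × L'_b → 𝒯_{a+b−2} which is symmetric, ⟨I,J⟩ = ⟨J,I⟩; that is, for fixed J the map I ↦ ⟨I,J⟩ sends antisymmetry and Jacobi relators of L'_a to relations in 𝒯_{a+b−2}, and similarly in the second variable. -/

import Mathlib

open scoped TensorProduct

/-- Rooted binary trees (formal non-associative bracket monomials) with
leaves labeled in `Fin m`.  The degree is the number of leaves, the order is
the degree minus one. -/
inductive RTree (m : ℕ) : Type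
  | leaf : Fin m → RTree m
  | node : RTree m → RTree m → RTree m

namespace RTree

/-- The degree of a rooted tree = its number of leaves. -/
def deg {m : ℕ} : RTree m → ℕ
  | leaf _ => 1
  | node a b => deg a + deg b

end RTree

/-- One-hole contexts for rooted trees. -/
inductive Ctx (m : ℕ) : Type
  | hole : Ctx m
  | nodeL : Ctx m → RTree m → Ctx m
  | nodeR : RTree m → Ctx m → Ctx m

/-- Fill the hole of a context with a rooted tree. -/
def Ctx.fill {m : ℕ} : Ctx m → RTree m → RTree m
  | .hole, t => t
  | .nodeL c r, t => RTree.node (c.fill t) r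
  | .nodeR l c, t => RTree.node l (c.fill t)

/-- Relators presenting the degree `n` part `L'_n` of the free quasi-Lie ring:
generators of the wrong degree are killed, and antisymmetry and Jacobi
relators are imposed at every position (one-hole context). -/
def quasiLieRels (m n : ℕ) : Set (FreeAbelianGroup (RTree m)) :=
  {x | ∃ J : RTree m, J.deg ≠ n ∧ x = FreeAbelianGroup.of J} ∪
  {x | ∃ (c : Ctx m) (A B : RTree m),
      x = FreeAbelianGroup.of (c.fill (RTree.node A B)) +
          FreeAbelianGroup.of (c.fill (RTree.node B A))} ∪
  {x | ∃ (c : Ctx m) (A B C : RTree m),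
      x = FreeAbelianGroup.of (c.fill (RTree.node A (RTree.node B C))) -
          FreeAbelianGroup.of (c.fill (RTree.node (RTree.node A B) C)) -
          FreeAbelianGroup.of (c.fill (RTree.node B (RTree.node A C)))}

/-- `L'_n`, the degree `n` part of Levine's free quasi-Lie ring on `X_1,…,X_m`. -/
abbrev Lp (m n : ℕ) :=
  FreeAbelianGroup (RTree m) ⧸ AddSubgroup.closure (quasiLieRels m n)

/-- The canonical projection onto `L'_n`. -/
abbrev LpMk (m n : ℕ) : FreeAbelianGroup (RTree m) →+ Lp m n :=
  QuotientAddGroup.mk' _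

/-- Relators for the free Lie ring: additionally kill all squares `[J,J]`
(at every position). -/
def lieRels (m n : ℕ) : Set (FreeAbelianGroup (RTree m)) :=
  quasiLieRels m n ∪
  {x | ∃ (c : Ctx m) (J : RTree m), x = FreeAbelianGroup.of (c.fill (RTree.node J J))}

/-- `L_n`, the degree `n` part of the free Lie ring on `X_1,…,X_m` over `ℤ`. -/
abbrev LL (m n : ℕ) :=
  FreeAbelianGroup (RTree m) ⧸ AddSubgroup.closure (lieRels m n)

/-- The canonical projection onto `L_n`. -/
abbrev LLMk (m n : ℕ) : FreeAbelianGroup (RTree m) →+ LL m n :=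
  QuotientAddGroup.mk' _

/-- The canonical projection `L'_n → L_n`. -/
def LpToLL (m n : ℕ) : Lp m n →+ LL m n :=
  QuotientAddGroup.map _ _ (AddMonoidHom.id _)
    (by
      rw [AddSubgroup.comap_id]
      exact AddSubgroup.closure_mono Set.subset_union_left)

/-- Free-level bracketing `t ↦ [X i, t]` with a degree one generator. -/
def brLeafFree (m : ℕ) (i : Fin m) :
    FreeAbelianGroup (RTree m) →+ FreeAbelianGroup (RTree m) :=
  FreeAbelianGroup.lift fun t => FreeAbelianGroup.of (RTree.node (RTree.leaf i) t)

theorem brLeafFree_mem_quasi {m n : ℕ} (i : Fin m) {x : FreeAbelianGroup (RTree m)}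
    (hx : x ∈ quasiLieRels m n) :
    brLeafFree m i x ∈ AddSubgroup.closure (quasiLieRels m (n + 1)) := by
  apply AddSubgroup.subset_closure
  rcases hx with (⟨J, hJ, rfl⟩ | ⟨c, A, B, rfl⟩) | ⟨c, A, B, C, rfl⟩
  · refine Or.inl (Or.inl ⟨RTree.node (RTree.leaf i) J, ?_, ?_⟩)
    · simp only [RTree.deg]; omega
    · simp [brLeafFree]
  · refine Or.inl (Or.inr ⟨Ctx.nodeR (RTree.leaf i) c, A, B, ?_⟩)
    simp [brLeafFree, Ctx.fill]
  · refine Or.inr ⟨Ctx.nodeR (RTree.leaf i) c, A, B, C, ?_⟩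
    simp [brLeafFree, Ctx.fill]

theorem brLeafFree_closure_quasi {m n : ℕ} (i : Fin m) :
    AddSubgroup.closure (quasiLieRels m n) ≤
      (AddSubgroup.closure (quasiLieRels m (n + 1))).comap (brLeafFree m i) :=
  (AddSubgroup.closure_le _).2 fun _x hx =>
    AddSubgroup.mem_comap.2 (brLeafFree_mem_quasi i hx)

/-- Bracketing `[X_i, ·] : L'_n → L'_{n+1}` with a degree one generator. -/
def brLeaf (m n : ℕ) (i : Fin m) : Lp m n →+ Lp m (n + 1) :=
  QuotientAddGroup.map _ _ (brLeafFree m i) (brLeafFree_closure_quasi i)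

theorem brLeafFree_mem_lie {m n : ℕ} (i : Fin m) {x : FreeAbelianGroup (RTree m)}
    (hx : x ∈ lieRels m n) :
    brLeafFree m i x ∈ AddSubgroup.closure (lieRels m (n + 1)) := by
  apply AddSubgroup.subset_closure
  rcases hx with ((⟨J, hJ, rfl⟩ | ⟨c, A, B, rfl⟩) | ⟨c, A, B, C, rfl⟩) | ⟨c, J, rfl⟩
  · refine Or.inl (Or.inl (Or.inl ⟨RTree.node (RTree.leaf i) J, ?_, ?_⟩))
    · simp only [RTree.deg]; omega
    · simp [brLeafFree]
  · exact Or.inl (Or.inl (Or.inr ⟨Ctx.nodeR (RTree.leaf i) c, A, B, by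
      simp [brLeafFree, Ctx.fill]⟩))
  · exact Or.inl (Or.inr ⟨Ctx.nodeR (RTree.leaf i) c, A, B, C, by
      simp [brLeafFree, Ctx.fill]⟩)
  · exact Or.inr ⟨Ctx.nodeR (RTree.leaf i) c, J, by simp [brLeafFree, Ctx.fill]⟩

theorem brLeafFree_closure_lie {m n : ℕ} (i : Fin m) :
    AddSubgroup.closure (lieRels m n) ≤
      (AddSubgroup.closure (lieRels m (n + 1))).comap (brLeafFree m i) :=
  (AddSubgroup.closure_le _).2 fun _x hx =>
    AddSubgroup.mem_comap.2 (brLeafFree_mem_lie i hx)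

/-- Bracketing `[X_i, ·] : L_n → L_{n+1}` with a degree one generator. -/
def brLeafL (m n : ℕ) (i : Fin m) : LL m n →+ LL m (n + 1) :=
  QuotientAddGroup.map _ _ (brLeafFree m i) (brLeafFree_closure_lie i)

/-- The bracket map `L'_1 ⊗ L'_a → L'_{a+1}`, `X_i ⊗ Y ↦ [X_i, Y]`,
where `L'_1 = L_1 ≅ ℤ^m` is realized as `FreeAbelianGroup (Fin m)` with basis `X_i`.
The kernel of `bracketLp m (n+1)` is the group `D'_n`. -/
noncomputable def bracketLp (m a : ℕ) :
    (FreeAbelianGroup (Fin m)) ⊗[ℤ] (Lp m a) →ₗ[ℤ] Lp m (a + 1) :=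
  TensorProduct.lift
    ((FreeAbelianGroup.lift fun i => (brLeaf m a i).toIntLinearMap).toIntLinearMap)

/-- The bracket map `L_1 ⊗ L_a → L_{a+1}`.  The kernel of `bracketLL m (n+1)` is `D_n`. -/
noncomputable def bracketLL (m a : ℕ) :
    (FreeAbelianGroup (Fin m)) ⊗[ℤ] (LL m a) →ₗ[ℤ] LL m (a + 1) :=
  TensorProduct.lift
    ((FreeAbelianGroup.lift fun i => (brLeafL m a i).toIntLinearMap).toIntLinearMap)

/-- `id ⊗ proj : L_1 ⊗ L'_n → L_1 ⊗ L_n`. -/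
noncomputable def projT (m n : ℕ) :
    (FreeAbelianGroup (Fin m)) ⊗[ℤ] (Lp m n) →ₗ[ℤ]
      (FreeAbelianGroup (Fin m)) ⊗[ℤ] (LL m n) :=
  LinearMap.lTensor _ (LpToLL m n).toIntLinearMap

/-- Given a rooted tree `t` and a rooted tree `rest` (representing the rest of the
unrooted tree `⟨t, rest⟩` hanging off the root edge of `t`), list, for each leaf `v`
of `t`, the label of `v` together with the rooted tree obtained from the unrooted
tree `⟨t, rest⟩` by making `v` the root. -/
def rerootList {m : ℕ} : RTree m → RTree m → List (Fin m × RTree m)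
  | RTree.leaf i, rest => [(i, rest)]
  | RTree.node a b, rest =>
      rerootList a (RTree.node b rest) ++ rerootList b (RTree.node rest a)

/-- All univalent vertices of the unrooted tree `⟨p.1, p.2⟩`, together with the
corresponding rerooted trees. -/
def pairReroots {m : ℕ} (p : RTree m × RTree m) : List (Fin m × RTree m) :=
  rerootList p.1 p.2 ++ rerootList p.2 p.1

/-- Relators presenting the order `n` tree group `𝒯_n`.  An unrooted unitrivalent
labeled vertex-oriented tree is presented as the inner product `⟨I,J⟩` of a pair of
rooted trees (cutting an edge); generators of the wrong order are killed, and we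
impose: symmetry `⟨I,J⟩ = ⟨J,I⟩`, edge-sliding `⟨(A,B),C⟩ = ⟨A,(B,C)⟩` (both of
which express that the pair presents the same unrooted tree), antisymmetry (AS),
and Jacobi (IHX) relations. -/
def treeRels (m n : ℕ) : Set (FreeAbelianGroup (RTree m × RTree m)) :=
  {x | ∃ p : RTree m × RTree m, p.1.deg + p.2.deg ≠ n + 2 ∧ x = FreeAbelianGroup.of p} ∪
  {x | ∃ I J : RTree m, x = FreeAbelianGroup.of (I, J) - FreeAbelianGroup.of (J, I)} ∪
  {x | ∃ A B C : RTree m,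
      x = FreeAbelianGroup.of (RTree.node A B, C) - FreeAbelianGroup.of (A, RTree.node B C)} ∪
  {x | ∃ A B C : RTree m,
      x = FreeAbelianGroup.of (RTree.node A B, C) + FreeAbelianGroup.of (RTree.node B A, C)} ∪
  {x | ∃ A B C D : RTree m,
      x = FreeAbelianGroup.of (RTree.node A (RTree.node B C), D)
        - FreeAbelianGroup.of (RTree.node (RTree.node A B) C, D)
        - FreeAbelianGroup.of (RTree.node B (RTree.node A C), D)}

/-- `𝒯_n`, the order `n` tree group. -/
abbrev Tgrp (m n : ℕ) :=
  FreeAbelianGroup (RTree m × RTree m) ⧸ AddSubgroup.closure (treeRels m n)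

/-- The canonical projection onto `𝒯_n`; the generator `⟨I,J⟩` is `TMk m n (.of (I,J))`. -/
abbrev TMk (m n : ℕ) : FreeAbelianGroup (RTree m × RTree m) →+ Tgrp m n :=
  QuotientAddGroup.mk' _

/-- The boundary-twist relators `⟨(i,J),J⟩` (for `J` of order `k-1`, i.e. degree `k`). -/
def btRels (m k : ℕ) : Set (FreeAbelianGroup (RTree m × RTree m)) :=
  {x | ∃ (i : Fin m) (J : RTree m), J.deg = k ∧
      x = FreeAbelianGroup.of (RTree.node (RTree.leaf i) J, J)}

/-- `𝒯^∞_{2k-1}`, the quotient of `𝒯_{2k-1}` by the boundary-twist relations. -/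
abbrev Tinfodd (m k : ℕ) :=
  FreeAbelianGroup (RTree m × RTree m) ⧸
    AddSubgroup.closure (treeRels m (2 * k - 1) ∪ btRels m k)

abbrev TinfoddMk (m k : ℕ) : FreeAbelianGroup (RTree m × RTree m) →+ Tinfodd m k :=
  QuotientAddGroup.mk' _

/-- Relators presenting `𝒯^∞_{2k}`: generators are order `2k` unrooted trees
(`Sum.inl` of a pair of rooted trees, as in `treeRels`) together with `∞`-trees
`J^∞` (`Sum.inr J`) for rooted trees `J` of order `k` (degree `k+1`).  Relations:
the relations of `𝒯_{2k}` among the non-`∞` trees, wrong-degree `∞`-generators are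
killed, the symmetry relations `(-J)^∞ = J^∞`, the twisted IHX relations
`I^∞ = H^∞ + X^∞ - ⟨H,X⟩`, and the interior-twist relations `2 J^∞ = ⟨J,J⟩`. -/
def tinfRels (m k : ℕ) : Set (FreeAbelianGroup ((RTree m × RTree m) ⊕ RTree m)) :=
  (⇑(FreeAbelianGroup.map (Sum.inl : RTree m × RTree m → (RTree m × RTree m) ⊕ RTree m)) ''
      treeRels m (2 * k)) ∪
  {x | ∃ J : RTree m, J.deg ≠ k + 1 ∧ x = FreeAbelianGroup.of (Sum.inr J)} ∪
  {x | ∃ (c : Ctx m) (A B : RTree m),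
      x = FreeAbelianGroup.of (Sum.inr (c.fill (RTree.node A B)))
        - FreeAbelianGroup.of (Sum.inr (c.fill (RTree.node B A)))} ∪
  {x | ∃ (c : Ctx m) (A B C : RTree m),
      x = FreeAbelianGroup.of (Sum.inr (c.fill (RTree.node A (RTree.node B C))))
        - FreeAbelianGroup.of (Sum.inr (c.fill (RTree.node (RTree.node A B) C)))
        - FreeAbelianGroup.of (Sum.inr (c.fill (RTree.node B (RTree.node A C))))
        + FreeAbelianGroup.of (Sum.inl (c.fill (RTree.node (RTree.node A B) C),
            c.fill (RTree.node B (RTree.node A C))))} ∪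
  {x | ∃ J : RTree m,
      x = FreeAbelianGroup.of (Sum.inr J) + FreeAbelianGroup.of (Sum.inr J)
        - FreeAbelianGroup.of (Sum.inl (J, J))}

/-- `𝒯^∞_{2k}`, the twisted tree group in even order `2k`. -/
abbrev Tinf (m k : ℕ) :=
  FreeAbelianGroup ((RTree m × RTree m) ⊕ RTree m) ⧸ AddSubgroup.closure (tinfRels m k)

abbrev TinfMk (m k : ℕ) :
    FreeAbelianGroup ((RTree m × RTree m) ⊕ RTree m) →+ Tinf m k :=
  QuotientAddGroup.mk' _

/-- The degree-guarded free-level bracket: for `s, t` rooted trees,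
`brFree m a b (of s) (of t) = of [s,t]` if `s` has degree `a` and `t` degree `b`,
and `0` otherwise.  It induces the bracket `L'_a × L'_b → L'_{a+b}`. -/
def brFree (m a b : ℕ) :
    FreeAbelianGroup (RTree m) →+
      FreeAbelianGroup (RTree m) →+ FreeAbelianGroup (RTree m) :=
  FreeAbelianGroup.lift fun s =>
    FreeAbelianGroup.lift fun t =>
      if s.deg = a ∧ t.deg = b then FreeAbelianGroup.of (RTree.node s t) else 0
/-- Replacing the subtree in a context by one of the same degree preserves the degree. -/
theorem Ctx.deg_fill_congr {m : ℕ} (c : Ctx m) {s t : RTree m} (h : s.deg = t.deg) :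
    (c.fill s).deg = (c.fill t).deg := by
  induction c with
  | hole => exact h
  | nodeL c r ih => simp only [Ctx.fill, RTree.deg, ih]
  | nodeR l c ih => simp only [Ctx.fill, RTree.deg, ih]

/-- A function on rooted trees that respects the quasi-Lie relations extends to a
homomorphism killing all quasi-Lie relators. -/
theorem quasiLieRels_closure_le_ker {m n : ℕ} {G : Type*} [AddCommGroup G] (f : RTree m → G)
    (hdeg : ∀ I : RTree m, I.deg ≠ n → f I = 0)
    (hanti : ∀ (c : Ctx m) (X Y : RTree m),
      f (c.fill (X.node Y)) + f (c.fill (Y.node X)) = 0)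
    (hjac : ∀ (c : Ctx m) (X Y Z : RTree m),
      f (c.fill (X.node (Y.node Z))) - f (c.fill ((X.node Y).node Z))
        - f (c.fill (Y.node (X.node Z))) = 0) :
    AddSubgroup.closure (quasiLieRels m n) ≤ (FreeAbelianGroup.lift f).ker := by
  refine (AddSubgroup.closure_le _).2 ?_
  rintro x ((⟨J, hJ, rfl⟩ | ⟨c, X, Y, rfl⟩) | ⟨c, X, Y, Z, rfl⟩)
  · simpa [AddMonoidHom.mem_ker] using hdeg J hJ
  · simpa [AddMonoidHom.mem_ker] using hanti c X Y
  · simpa [AddMonoidHom.mem_ker] using hjac c X Y Z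

/-- The class of the unrooted tree `⟨I, J⟩` in `𝒯_n`. -/
def treeClass {m : ℕ} (n : ℕ) (I J : RTree m) : Tgrp m n :=
  TMk m n (FreeAbelianGroup.of (I, J))

section treeClass

variable {m n : ℕ}

theorem TMk_eq_zero {x : FreeAbelianGroup (RTree m × RTree m)} (hx : x ∈ treeRels m n) :
    TMk m n x = 0 :=
  (QuotientAddGroup.eq_zero_iff x).2 (AddSubgroup.subset_closure hx)

theorem treeClass_eq_zero {I J : RTree m} (h : I.deg + J.deg ≠ n + 2) :
    treeClass n I J = 0 :=
  TMk_eq_zero (Or.inl (Or.inl (Or.inl (Or.inl ⟨(I, J), h, rfl⟩))))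

theorem treeClass_comm (I J : RTree m) : treeClass n I J = treeClass n J I := by
  rw [← sub_eq_zero]
  simpa only [map_sub, treeClass] using
    TMk_eq_zero (n := n) (Or.inl (Or.inl (Or.inl (Or.inr ⟨I, J, rfl⟩))))

theorem treeClass_node_left (X Y Z : RTree m) :
    treeClass n (X.node Y) Z = treeClass n X (Y.node Z) := by
  rw [← sub_eq_zero]
  simpa only [map_sub, treeClass] using
    TMk_eq_zero (n := n) (Or.inl (Or.inl (Or.inr ⟨X, Y, Z, rfl⟩)))

theorem treeClass_antisymm (X Y J : RTree m) :
    treeClass n (X.node Y) J + treeClass n (Y.node X) J = 0 := by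
  simpa only [map_add, treeClass] using TMk_eq_zero (n := n) (Or.inl (Or.inr ⟨X, Y, J, rfl⟩))

theorem treeClass_jacobi (X Y Z J : RTree m) :
    treeClass n (X.node (Y.node Z)) J - treeClass n ((X.node Y).node Z) J
      - treeClass n (Y.node (X.node Z)) J = 0 := by
  simpa only [map_sub, treeClass] using TMk_eq_zero (n := n) (Or.inr ⟨X, Y, Z, J, rfl⟩)

/-- Cutting the unrooted tree `⟨c.fill t, J⟩` at the root edge of `t` instead. -/
theorem exists_treeClass_fill (c : Ctx m) (J : RTree m) :
    ∃ K : RTree m, ∀ t : RTree m, treeClass n (c.fill t) J = treeClass n t K := by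
  induction c generalizing J with
  | hole => exact ⟨J, fun _ => rfl⟩
  | nodeL c r ih =>
    obtain ⟨K, hK⟩ := ih (r.node J)
    exact ⟨K, fun t => (treeClass_node_left _ _ _).trans (hK t)⟩
  | nodeR l c ih =>
    obtain ⟨K, hK⟩ := ih (J.node l)
    refine ⟨K, fun t => ?_⟩
    rw [Ctx.fill, treeClass_node_left, treeClass_comm, treeClass_node_left, hK]

theorem treeClass_fill_antisymm (c : Ctx m) (X Y J : RTree m) :
    treeClass n (c.fill (X.node Y)) J + treeClass n (c.fill (Y.node X)) J = 0 := by
  obtain ⟨K, hK⟩ := exists_treeClass_fill (n := n) c J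
  rw [hK, hK, treeClass_antisymm]

theorem treeClass_fill_jacobi (c : Ctx m) (X Y Z J : RTree m) :
    treeClass n (c.fill (X.node (Y.node Z))) J - treeClass n (c.fill ((X.node Y).node Z)) J
      - treeClass n (c.fill (Y.node (X.node Z))) J = 0 := by
  obtain ⟨K, hK⟩ := exists_treeClass_fill (n := n) c J
  rw [hK, hK, hK, treeClass_jacobi]

end treeClass

/-- The homomorphism `⟨I, ·⟩ : L'_b → 𝒯_n` for a rooted tree `I` of degree `n + 2 - b`. -/
def pairLeft {m b n : ℕ} (I : RTree m) (hI : I.deg + b = n + 2) : Lp m b →+ Tgrp m n :=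
  QuotientAddGroup.lift _ (FreeAbelianGroup.lift fun J => treeClass n J I) <|
    quasiLieRels_closure_le_ker _
      (fun _ hJ => treeClass_eq_zero fun h => hJ (by omega))
      (fun c X Y => treeClass_fill_antisymm c X Y I)
      (fun c X Y Z => treeClass_fill_jacobi c X Y Z I)

theorem pairLeft_mk_of {m b n : ℕ} (I : RTree m) (hI : I.deg + b = n + 2) (J : RTree m) :
    pairLeft I hI (LpMk m b (FreeAbelianGroup.of J)) = treeClass n I J :=
  (FreeAbelianGroup.lift_apply_of _ J).trans (treeClass_comm J I)

theorem Lp_hom_ext {m b : ℕ} {G : Type*} [AddCommGroup G] {f g : Lp m b →+ G}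
    (h : ∀ J : RTree m,
      f (LpMk m b (FreeAbelianGroup.of J)) = g (LpMk m b (FreeAbelianGroup.of J))) :
    f = g :=
  QuotientAddGroup.addMonoidHom_ext _ (FreeAbelianGroup.lift_ext _ _ h)

/-- The inner product pairing `L'_a × L'_b → 𝒯_n`, where `a + b = n + 2`. -/
def treePairing {m a b n : ℕ} (h : a + b = n + 2) : Lp m a →+ Lp m b →+ Tgrp m n :=
  QuotientAddGroup.lift _
    (FreeAbelianGroup.lift fun I =>
      if hI : I.deg = a then pairLeft I (hI.symm ▸ h) else 0) <| by
    refine quasiLieRels_closure_le_ker _ (fun I hI => dif_neg hI) (fun c X Y => ?_)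
      (fun c X Y Z => ?_)
    · have h₁ : (c.fill (Y.node X)).deg = (c.fill (X.node Y)).deg :=
        c.deg_fill_congr (by simp only [RTree.deg]; omega)
      by_cases hd : (c.fill (X.node Y)).deg = a
      · rw [dif_pos hd, dif_pos (h₁.trans hd)]
        refine Lp_hom_ext fun J => ?_
        simp only [AddMonoidHom.add_apply, AddMonoidHom.zero_apply, pairLeft_mk_of,
          treeClass_fill_antisymm]
      · rw [dif_neg hd, dif_neg (h₁.trans_ne hd), add_zero]
    · have h₁ : (c.fill ((X.node Y).node Z)).deg = (c.fill (X.node (Y.node Z))).deg :=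
        c.deg_fill_congr (by simp only [RTree.deg]; omega)
      have h₂ : (c.fill (Y.node (X.node Z))).deg = (c.fill (X.node (Y.node Z))).deg :=
        c.deg_fill_congr (by simp only [RTree.deg]; omega)
      by_cases hd : (c.fill (X.node (Y.node Z))).deg = a
      · rw [dif_pos hd, dif_pos (h₁.trans hd), dif_pos (h₂.trans hd)]
        refine Lp_hom_ext fun J => ?_
        simp only [AddMonoidHom.sub_apply, AddMonoidHom.zero_apply, pairLeft_mk_of,
          treeClass_fill_jacobi]
      · rw [dif_neg hd, dif_neg (h₁.trans_ne hd), dif_neg (h₂.trans_ne hd), sub_zero, sub_zero]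

theorem treePairing_mk_of {m a b n : ℕ} (h : a + b = n + 2) {I : RTree m} (hI : I.deg = a)
    (J : RTree m) :
    treePairing h (LpMk m a (FreeAbelianGroup.of I)) (LpMk m b (FreeAbelianGroup.of J))
      = treeClass n I J := by
  have hlift : treePairing h (LpMk m a (FreeAbelianGroup.of I))
      = pairLeft (b := b) I (hI.symm ▸ h) :=
    (FreeAbelianGroup.lift_apply_of _ I).trans (dif_pos hI)
  rw [hlift, pairLeft_mk_of]

/-- For all `m ≥ 1` and degrees `a, b ≥ 1`, the inner product of rooted
trees descends to a well-defined ℤ-bilinear pairing `⟨·,·⟩ : L'_a × L'_b → 𝒯_{a+b-2}`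
which is symmetric: `⟨I,J⟩ = ⟨J,I⟩`.  (A rooted tree of degree `n` has order `n-1`,
so `⟨I,J⟩` has order `(a-1)+(b-1) = a+b-2`.) -/
theorem statement18 (m a b : ℕ) (hm : 1 ≤ m) (ha : 1 ≤ a) (hb : 1 ≤ b) :
    ∃ B : Lp m a →+ Lp m b →+ Tgrp m (a + b - 2),
      (∀ I J : RTree m, I.deg = a → J.deg = b →
        B (LpMk m a (FreeAbelianGroup.of I)) (LpMk m b (FreeAbelianGroup.of J))
          = TMk m (a + b - 2) (FreeAbelianGroup.of (I, J))) ∧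
      (∀ I J : RTree m, I.deg = a → J.deg = b →
        B (LpMk m a (FreeAbelianGroup.of I)) (LpMk m b (FreeAbelianGroup.of J))
          = TMk m (a + b - 2) (FreeAbelianGroup.of (J, I))) := by
  have h : a + b = a + b - 2 + 2 := by omega
  exact ⟨treePairing h, fun I J hI _ => treePairing_mk_of h hI J,
    fun I J hI _ => (treePairing_mk_of h hI J).trans (treeClass_comm I J)⟩
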